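/- Let n ≥ 1, p₀ ∈ (0,1), δ := n/p₀ - (n+1)/2, and N := ⌊n(1/p₀ - 1)⌋. Let Q ⊂ ℝ^n be a cube with center x_Q and side length ℓ > 0, and let a ∈ L¹(ℝ^n) be supported in Q with ∫_{ℝ^n} |a(y)| dy ≤ |Q| and with vanishing moments ∫_{ℝ^n} y^β a(y) dy = 0 for every multi-index β with |β| ≤ N. Then there exists a constant C > 0, depending only on n and p₀ (not on a, Q, x or ε), such that for every x outside the cube 4Q (the cube with center x_Q and side length 4ℓ) and every ε > (3/4)|x - x_Q|, the Bochner–Riesz means of a satisfies |(a * φ_ε)(x)| ≤ C (ℓ / |x - x_Q|)^{δ + (n+1)/2}. -/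

import Mathlib

noncomputable section

open MeasureTheory Real Set
open scoped ENNReal NNReal

abbrev En (n : ℕ) : Type := EuclideanSpace ℝ (Fin n)

/-- The Bochner–Riesz kernel of order `δ`: the Fourier transform of `ξ ↦ ((1-|ξ|²)⁺)^δ`. -/
def brKernel (n : ℕ) (δ : ℝ) (x : En n) : ℂ :=
  ∫ ξ : En n, (((max (1 - ‖ξ‖ ^ 2) 0) ^ δ : ℝ) : ℂ) *
    Complex.exp (-(2 * Real.pi) * Complex.I * ((∑ i, x i * ξ i : ℝ) : ℂ))

/-- The dilated kernel `φ_ε(x) = ε^{-n} φ(x/ε)`. -/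
def brKernelDil (n : ℕ) (δ ε : ℝ) (x : En n) : ℂ :=
  (ε ^ n)⁻¹ • brKernel n δ (ε⁻¹ • x)

/-- The Bochner–Riesz means `B^δ_{1/ε} f = f * φ_ε`. -/
def brMeans (n : ℕ) (δ ε : ℝ) (f : En n → ℂ) (x : En n) : ℂ :=
  ∫ y, f y * brKernelDil n δ ε (x - y)

/-- The maximal Bochner–Riesz means `B^δ_* f`. -/
def brMax (n : ℕ) (δ : ℝ) (f : En n → ℂ) (x : En n) : ℝ≥0∞ :=
  ⨆ (ε : ℝ) (_ : 0 < ε), (‖brMeans n δ ε f x‖₊ : ℝ≥0∞)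

/-- The radial maximal function `M(f,Φ)(x) = sup_{t>0} |(Φ_t * f)(x)|`. -/
def radMax (n : ℕ) (Φ : En n → ℂ) (f : En n → ℂ) (x : En n) : ℝ≥0∞ :=
  ⨆ (t : ℝ) (_ : 0 < t), (‖∫ y, (t ^ n)⁻¹ • Φ (t⁻¹ • (x - y)) * f y‖₊ : ℝ≥0∞)

lemma br_integrable_mul {n : ℕ} {xQ : En n} {ℓ : ℝ} {a : En n → ℂ} (ha : Integrable a volume)
    (hs : Function.support a ⊆ {y : En n | ∀ i, |y i - xQ i| ≤ ℓ / 2})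
    {g : En n → ℂ} (hg : Continuous g) : Integrable (fun y => g y * a y) volume := by
  have hK : Bornology.IsBounded {y : En n | ∀ i, |y i - xQ i| ≤ ℓ / 2} := by
    refine (Metric.isBounded_iff_subset_closedBall xQ).2 ⟨√(∑ _i : Fin n, (ℓ / 2) ^ 2), ?_⟩
    intro y hy
    rw [mem_closedBall_iff_norm, EuclideanSpace.norm_eq]
    refine Real.sqrt_le_sqrt (Finset.sum_le_sum fun i _ => ?_)
    exact pow_le_pow_left₀ (norm_nonneg _) (hy i) 2
  have hc : IsCompact (closure {y : En n | ∀ i, |y i - xQ i| ≤ ℓ / 2}) :=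
    hK.isCompact_closure
  obtain ⟨B, hB⟩ := hc.exists_bound_of_continuousOn hg.continuousOn
  refine Integrable.mono' (ha.norm.const_mul B)
    (hg.aestronglyMeasurable.mul ha.aestronglyMeasurable) (Filter.Eventually.of_forall fun y => ?_)
  by_cases h : a y = 0
  · simp [h]
  · rw [norm_mul]
    exact mul_le_mul_of_nonneg_right (hB y (subset_closure (hs h))) (norm_nonneg _)

lemma br_poly_moment {n : ℕ} {xQ : En n} {ℓ : ℝ} {a : En n → ℂ} (ha : Integrable a volume)
    (hs : Function.support a ⊆ {y : En n | ∀ i, |y i - xQ i| ≤ ℓ / 2}) {N : ℕ}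
    (hm : ∀ β : Fin n → ℕ, (∑ i, β i) ≤ N → (∫ y, (∏ i, ((y i : ℝ) : ℂ) ^ (β i)) * a y) = 0)
    (P : MvPolynomial (Fin n) ℂ) (hP : P.totalDegree ≤ N) :
    ∫ y : En n, MvPolynomial.eval (fun i => ((y i : ℝ) : ℂ)) P * a y = 0 := by
  simp_rw [MvPolynomial.eval_eq', Finset.sum_mul, mul_assoc]
  rw [integral_finsetSum]
  · refine Finset.sum_eq_zero fun d hd => ?_
    rw [integral_const_mul, hm, mul_zero]
    refine le_trans ?_ hP
    have := MvPolynomial.le_totalDegree hd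
    rwa [Finsupp.sum_fintype _ _ (fun _ => rfl)] at this
  · intro d _
    refine Integrable.const_mul ?_ _
    exact br_integrable_mul ha hs (by fun_prop)

lemma br_lin_moment {n : ℕ} {xQ : En n} {ℓ : ℝ} {a : En n → ℂ} (ha : Integrable a volume)
    (hs : Function.support a ⊆ {y : En n | ∀ i, |y i - xQ i| ≤ ℓ / 2}) {N : ℕ}
    (hm : ∀ β : Fin n → ℕ, (∑ i, β i) ≤ N → (∫ y, (∏ i, ((y i : ℝ) : ℂ) ^ (β i)) * a y) = 0)
    (ξ : En n) (k : ℕ) (hk : k ≤ N) :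
    ∫ y : En n, (((∑ i, (y i - xQ i) * ξ i : ℝ) : ℂ)) ^ k * a y = 0 := by
  have h := br_poly_moment ha hs hm
    ((∑ i, (MvPolynomial.X i - MvPolynomial.C ((xQ i : ℝ) : ℂ)) *
      MvPolynomial.C ((ξ i : ℝ) : ℂ)) ^ k) ?_
  · simpa using h
  · refine (MvPolynomial.totalDegree_pow _ _).trans ?_
    have : (∑ i, (MvPolynomial.X i - MvPolynomial.C ((xQ i : ℝ) : ℂ)) *
      MvPolynomial.C ((ξ i : ℝ) : ℂ) : MvPolynomial (Fin n) ℂ).totalDegree ≤ 1 := by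
      refine MvPolynomial.totalDegree_finsetSum_le fun i _ => ?_
      refine (MvPolynomial.totalDegree_mul _ _).trans ?_
      rw [MvPolynomial.totalDegree_C, add_zero]
      refine (MvPolynomial.totalDegree_sub _ _).trans ?_
      simp
    calc _ ≤ k * 1 := Nat.mul_le_mul_left _ this
      _ ≤ N := by omega

lemma br_inner_bound {n : ℕ} {xQ : En n} {ℓ : ℝ} {a : En n → ℂ} (hℓ : 0 < ℓ)
    (ha : Integrable a volume)
    (hs : Function.support a ⊆ {y : En n | ∀ i, |y i - xQ i| ≤ ℓ / 2}) {N : ℕ}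
    (hsize : (∫ y, ‖a y‖) ≤ ℓ ^ n)
    (hm : ∀ β : Fin n → ℕ, (∑ i, β i) ≤ N → (∫ y, (∏ i, ((y i : ℝ) : ℂ) ^ (β i)) * a y) = 0)
    (ξ : En n) (hξ : ‖ξ‖ ≤ 1) (ε : ℝ) (hε : ℓ ≤ ε) :
    ‖∫ y : En n, Complex.exp ((2 * π * ε⁻¹ * Complex.I) *
        ((∑ i, (y i - xQ i) * ξ i : ℝ) : ℂ)) * a y‖
      ≤ (π * n * (ℓ / ε)) ^ (N + 1) * Real.exp (π * n) * ℓ ^ n := by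
  set c : ℂ := 2 * π * ε⁻¹ * Complex.I with hc
  have hε0 : 0 < ε := hℓ.trans_le hε
  have hcn : ‖c‖ = 2 * π * ε⁻¹ := by
    simp [hc, abs_of_pos hε0, abs_of_pos Real.pi_pos]
  set T : En n → ℂ := fun y => ((∑ i, (y i - xQ i) * ξ i : ℝ) : ℂ) with hT
  have hTc : Continuous T := by
    simp only [hT]; fun_prop
  have hpoly : ∫ y : En n, (∑ k ∈ Finset.range (N + 1), (c * T y) ^ k / (k.factorial : ℂ)) * a y
      = 0 := by
    simp_rw [Finset.sum_mul]
    rw [integral_finsetSum]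
    · refine Finset.sum_eq_zero fun k hk => ?_
      have := br_lin_moment ha hs hm ξ k (by simpa [Nat.lt_succ_iff] using hk)
      have e : ∀ y : En n, (c * T y) ^ k / (k.factorial : ℂ) * a y
          = (c ^ k / (k.factorial : ℂ)) * (T y ^ k * a y) := fun y => by ring
      simp_rw [e]
      rw [integral_const_mul, this, mul_zero]
    · intro k _
      exact br_integrable_mul ha hs (by fun_prop)
  have hexp : Integrable (fun y => Complex.exp (c * T y) * a y) volume :=
    br_integrable_mul ha hs (by fun_prop)
  have hpi : Integrable (fun y : En n =>
      (∑ k ∈ Finset.range (N + 1), (c * T y) ^ k / (k.factorial : ℂ)) * a y) volume :=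
    br_integrable_mul ha hs (by fun_prop)
  have e1 : ∫ y : En n, Complex.exp (c * T y) * a y = ∫ y : En n, (Complex.exp (c * T y) -
      ∑ k ∈ Finset.range (N + 1), (c * T y) ^ k / (k.factorial : ℂ)) * a y := by
    simp_rw [sub_mul]
    rw [integral_sub hexp hpi, hpoly, sub_zero]
  rw [e1]
  set D : ℝ := (π * n * (ℓ / ε)) ^ (N + 1) * Real.exp (π * n) with hD
  have hD0 : 0 ≤ D := by positivity
  have hpt : ∀ y : En n, ‖(Complex.exp (c * T y) -
      ∑ k ∈ Finset.range (N + 1), (c * T y) ^ k / (k.factorial : ℂ)) * a y‖ ≤ D * ‖a y‖ := by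
    intro y
    by_cases h : a y = 0
    · simp [h]
    rw [norm_mul]
    refine mul_le_mul_of_nonneg_right ?_ (norm_nonneg _)
    have hy := hs h
    have hTy : ‖T y‖ ≤ n * (ℓ / 2) := by
      rw [hT, Complex.norm_real, Real.norm_eq_abs]
      refine (Finset.abs_sum_le_sum_abs _ _).trans ?_
      calc ∑ i, |(y i - xQ i) * ξ i| ≤ ∑ _i : Fin n, ℓ / 2 := by
            refine Finset.sum_le_sum fun i _ => ?_
            rw [abs_mul]
            have h1 : |ξ i| ≤ 1 := (PiLp.norm_apply_le ξ i).trans hξ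
            calc _ ≤ (ℓ / 2) * 1 := mul_le_mul (hy i) h1 (abs_nonneg _) (by positivity)
              _ = _ := mul_one _
        _ = _ := by simp
    have hle : ‖c * T y‖ ≤ π * n * (ℓ / ε) := by
      rw [norm_mul, hcn]
      calc _ ≤ 2 * π * ε⁻¹ * (n * (ℓ / 2)) := by gcongr
        _ = _ := by field_simp
    have hle' : ‖c * T y‖ ≤ π * n := by
      refine hle.trans ?_
      have : ℓ / ε ≤ 1 := (div_le_one hε0).2 hε
      exact mul_le_of_le_one_right (by positivity) this
    refine (Complex.norm_exp_sub_sum_le_norm_mul_exp (c * T y) (N + 1)).trans ?_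
    rw [hD]
    gcongr
  refine (norm_integral_le_of_norm_le (ha.norm.const_mul D)
    (Filter.Eventually.of_forall hpt)).trans ?_
  rw [integral_const_mul]
  exact mul_le_mul_of_nonneg_left hsize hD0

lemma br_mult_continuous {n : ℕ} {δ : ℝ} (hδ : 0 < δ) :
    Continuous (fun ξ : En n => (max (1 - ‖ξ‖ ^ 2) 0) ^ δ) := by
  refine Continuous.rpow_const (by fun_prop) fun _ => Or.inr hδ.le

lemma br_mult_zero {n : ℕ} {δ : ℝ} (hδ : 0 < δ) (ξ : En n) (h : 1 < ‖ξ‖) :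
    (max (1 - ‖ξ‖ ^ 2) 0) ^ δ = 0 := by
  rw [max_eq_right (by nlinarith), Real.zero_rpow hδ.ne']

lemma br_mult_integrable {n : ℕ} {δ : ℝ} (hδ : 0 < δ) :
    Integrable (fun ξ : En n => (max (1 - ‖ξ‖ ^ 2) 0) ^ δ) volume := by
  refine (br_mult_continuous hδ).integrable_of_hasCompactSupport ?_
  refine HasCompactSupport.intro (isCompact_closedBall (0 : En n) 1) fun ξ h => ?_
  refine br_mult_zero hδ ξ ?_
  simpa using h

lemma br_means_bound {n : ℕ} {δ : ℝ} (hδ : 0 < δ) {xQ : En n} {ℓ : ℝ} {a : En n → ℂ} (hℓ : 0 < ℓ)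
    (ha : Integrable a volume)
    (hs : Function.support a ⊆ {y : En n | ∀ i, |y i - xQ i| ≤ ℓ / 2}) {N : ℕ}
    (hsize : (∫ y, ‖a y‖) ≤ ℓ ^ n)
    (hm : ∀ β : Fin n → ℕ, (∑ i, β i) ≤ N → (∫ y, (∏ i, ((y i : ℝ) : ℂ) ^ (β i)) * a y) = 0)
    (x : En n) (ε : ℝ) (hε : ℓ ≤ ε) :
    ‖brMeans n δ ε a x‖ ≤ (ε ^ n)⁻¹ * ((∫ ξ : En n, (max (1 - ‖ξ‖ ^ 2) 0) ^ δ) *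
      ((π * n * (ℓ / ε)) ^ (N + 1) * Real.exp (π * n) * ℓ ^ n)) := by
  have hε0 : 0 < ε := hℓ.trans_le hε
  set m : En n → ℝ := fun ξ => (max (1 - ‖ξ‖ ^ 2) 0) ^ δ with hmdef
  have hm0 : ∀ ξ, 0 ≤ m ξ := fun ξ => Real.rpow_nonneg (le_max_right _ _) _
  set B : ℝ := (π * n * (ℓ / ε)) ^ (N + 1) * Real.exp (π * n) * ℓ ^ n with hB
  set c : ℂ := 2 * π * ε⁻¹ * Complex.I with hc
  set F : En n → En n → ℂ := fun y ξ =>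
    Complex.exp (-c * ((∑ i, (x i - y i) * ξ i : ℝ) : ℂ)) * (a y * (m ξ : ℂ)) with hF
  have hFint : Integrable (Function.uncurry F) (volume.prod volume) := by
    have h1 : Integrable (fun z : En n × En n => a z.1 * (m z.2 : ℂ)) (volume.prod volume) :=
      ha.mul_prod (br_mult_integrable hδ).ofReal
    refine h1.bdd_mul (c := 1) ?_ ?_
    · exact Continuous.aestronglyMeasurable (by fun_prop)
    · refine Filter.Eventually.of_forall fun z => ?_
      rw [Complex.norm_exp]
      simp [hc]
  have e1 : brMeans n δ ε a x = ((ε ^ n)⁻¹ : ℝ) • ∫ y, ∫ ξ, F y ξ := by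
    unfold brMeans brKernelDil brKernel
    rw [← integral_smul]
    refine integral_congr_ae (Filter.Eventually.of_forall fun y => ?_)
    simp only []
    rw [mul_smul_comm, ← integral_const_mul]
    congr 1
    refine integral_congr_ae (Filter.Eventually.of_forall fun ξ => ?_)
    simp only [hF, hmdef, hc]
    have : -(2 * (π : ℂ)) * Complex.I * ((∑ i, (ε⁻¹ • (x - y)) i * ξ i : ℝ) : ℂ)
      = -(2 * π * ε⁻¹ * Complex.I) * ((∑ i, (x i - y i) * ξ i : ℝ) : ℂ) := by
      have : (∑ i, (ε⁻¹ • (x - y)) i * ξ i : ℝ) = ε⁻¹ * ∑ i, (x i - y i) * ξ i := by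
        rw [Finset.mul_sum]
        refine Finset.sum_congr rfl fun i _ => ?_
        simp [mul_assoc]
      rw [this]
      push_cast
      ring
    rw [this]
    push_cast
    ring
  rw [e1, integral_integral_swap hFint, norm_smul, Real.norm_of_nonneg (by positivity)]
  refine mul_le_mul_of_nonneg_left ?_ (by positivity)
  rw [← integral_mul_const]
  refine norm_integral_le_of_norm_le ((br_mult_integrable hδ).mul_const B)
    (Filter.Eventually.of_forall fun ξ => ?_)
  have e2 : ∫ y, F y ξ = ((m ξ : ℂ) *
      Complex.exp (-c * ((∑ i, (x i - xQ i) * ξ i : ℝ) : ℂ))) *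
      ∫ y : En n, Complex.exp (c * ((∑ i, (y i - xQ i) * ξ i : ℝ) : ℂ)) * a y := by
    rw [← integral_const_mul]
    refine integral_congr_ae (Filter.Eventually.of_forall fun y => ?_)
    simp only [hF]
    have : -c * ((∑ i, (x i - y i) * ξ i : ℝ) : ℂ) = -c * ((∑ i, (x i - xQ i) * ξ i : ℝ) : ℂ)
        + c * ((∑ i, (y i - xQ i) * ξ i : ℝ) : ℂ) := by
      have : (∑ i, (x i - y i) * ξ i : ℝ) = (∑ i, (x i - xQ i) * ξ i) -
          ∑ i, (y i - xQ i) * ξ i := by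
        rw [← Finset.sum_sub_distrib]
        exact Finset.sum_congr rfl fun i _ => by ring
      rw [this]; push_cast; ring
    rw [this, Complex.exp_add]
    ring
  have hmB : (max (1 - ‖ξ‖ ^ 2) 0) ^ δ = m ξ := rfl
  rw [e2, hmB]
  by_cases hξ : ‖ξ‖ ≤ 1
  · rw [norm_mul, norm_mul, Complex.norm_real, Real.norm_of_nonneg (hm0 ξ)]
    have : ‖Complex.exp (-c * ((∑ i, (x i - xQ i) * ξ i : ℝ) : ℂ))‖ = 1 := by
      rw [Complex.norm_exp]
      simp [hc]
    rw [this, mul_one]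
    exact mul_le_mul_of_nonneg_left (br_inner_bound hℓ ha hs hsize hm ξ hξ ε hε) (hm0 ξ)
  · have : m ξ = 0 := br_mult_zero hδ ξ (not_le.1 hξ)
    simp [this]


/-- **Pointwise decay of the Bochner–Riesz means of an atom away from its supporting cube,
at the critical index `δ = n/p₀ - (n+1)/2`.** -/
theorem bochnerRiesz_atom_decay {n : ℕ} (hn : 1 ≤ n) (p₀ δ : ℝ)
    (hp₀0 : 0 < p₀) (hp₀1 : p₀ < 1)
    (hδ : δ = (n : ℝ) / p₀ - ((n : ℝ) + 1) / 2) :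
    ∃ C : ℝ, 0 < C ∧
      ∀ (xQ : En n) (ℓ : ℝ), 0 < ℓ →
      ∀ a : En n → ℂ, Integrable a volume →
        -- `a` is supported in the cube `Q` with center `xQ` and side length `ℓ`
        (Function.support a ⊆ {y : En n | ∀ i, |y i - xQ i| ≤ ℓ / 2}) →
        -- size condition `∫ |a| ≤ |Q|`
        ((∫ y, ‖a y‖) ≤ ℓ ^ n) →
        -- vanishing moments up to order `N = ⌊n(1/p₀ - 1)⌋`
        (∀ β : Fin n → ℕ, (∑ i, β i) ≤ Nat.floor ((n : ℝ) * (1 / p₀ - 1)) →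
          (∫ y, (∏ i, ((y i : ℝ) : ℂ) ^ (β i)) * a y) = 0) →
      -- then for `x` outside `4Q` and `ε > (3/4)|x - xQ|`:
      ∀ x : En n, x ∉ {y : En n | ∀ i, |y i - xQ i| ≤ 2 * ℓ} →
      ∀ ε : ℝ, 3 / 4 * ‖x - xQ‖ < ε →
        ‖brMeans n δ ε a x‖ ≤ C * (ℓ / ‖x - xQ‖) ^ (δ + ((n : ℝ) + 1) / 2) := by
  set N := Nat.floor ((n : ℝ) * (1 / p₀ - 1)) with hN
  have hn' : (1 : ℝ) ≤ n := by exact_mod_cast hn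
  have hnp : (n : ℝ) < n / p₀ := by
    rw [lt_div_iff₀ hp₀0]; nlinarith
  have hδ0 : 0 < δ := by rw [hδ]; linarith
  set M : ℝ := ∫ ξ : En n, (max (1 - ‖ξ‖ ^ 2) 0) ^ δ with hM
  have hM0 : 0 ≤ M := integral_nonneg fun ξ => Real.rpow_nonneg (le_max_right _ _) _
  refine ⟨M * (π * n) ^ (N + 1) * Real.exp (π * n) * (4 / 3) ^ (n + (N + 1)) + 1,
    by positivity, ?_⟩
  intro xQ ℓ hℓ a ha hs hsize hm x hx ε hε
  have hx2 : 2 * ℓ < ‖x - xQ‖ := by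
    simp only [mem_ofPred_eq, not_forall, not_le] at hx
    obtain ⟨i, hi⟩ := hx
    exact hi.trans_le (PiLp.norm_apply_le (x - xQ) i)
  set R := ‖x - xQ‖ with hR
  have hR0 : 0 < R := by linarith
  have hle : ℓ ≤ ε := by linarith
  have hε0 : 0 < ε := by linarith
  refine (br_means_bound hδ0 hℓ ha hs hsize hm x ε hle).trans ?_
  have hr1 : ℓ / R ≤ 1 := (div_le_one hR0).2 (by linarith)
  have hr0 : 0 < ℓ / R := by positivity
  have hexp : (ℓ / R) ^ (n + (N + 1)) ≤ (ℓ / R) ^ (δ + ((n : ℝ) + 1) / 2) := by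
    rw [← Real.rpow_natCast]
    refine Real.rpow_le_rpow_of_exponent_ge hr0 hr1 ?_
    have := Nat.lt_floor_add_one ((n : ℝ) * (1 / p₀ - 1))
    rw [← hN] at this
    push_cast
    have e : (n : ℝ) * (1 / p₀ - 1) = n / p₀ - n := by ring
    rw [e] at this
    rw [hδ]; linarith
  have hq : ℓ / ε ≤ 4 / 3 * (ℓ / R) := by
    rw [← mul_div_assoc, div_le_div_iff₀ hε0 hR0]
    nlinarith
  calc (ε ^ n)⁻¹ * (M * ((π * n * (ℓ / ε)) ^ (N + 1) * Real.exp (π * n) * ℓ ^ n))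
      = M * (π * n) ^ (N + 1) * Real.exp (π * n) * (ℓ / ε) ^ (n + (N + 1)) := by
        rw [pow_add (ℓ / ε) n (N + 1), mul_pow (π * (n : ℝ)), div_pow ℓ ε n]; ring
    _ ≤ M * (π * n) ^ (N + 1) * Real.exp (π * n) * (4 / 3 * (ℓ / R)) ^ (n + (N + 1)) := by
        gcongr
    _ = M * (π * n) ^ (N + 1) * Real.exp (π * n) * (4 / 3) ^ (n + (N + 1)) *
        (ℓ / R) ^ (n + (N + 1)) := by rw [mul_pow]; ring
    _ ≤ (M * (π * n) ^ (N + 1) * Real.exp (π * n) * (4 / 3) ^ (n + (N + 1)) + 1) *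
        (ℓ / R) ^ (δ + ((n : ℝ) + 1) / 2) := by
        gcongr
        linarith
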